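/- The sequence a(n) = Σ_D(n-1)/Σ_D(n), where Σ_D(n) = (3/2)((1+i)(4+3i)^n + (1-i)(4-3i)^n), is unbounded; in particular it does not converge. -/

import Mathlib

open Filter Complex

/-- The closed form `Σ_D(n) = (3/2)((1+i)(4+3i)^n + (1-i)(4-3i)^n)`, a real
number viewed through its real part. -/
noncomputable def dumasSigmaC (n : ℕ) : ℂ :=
  (3 / 2) * ((1 + I) * (4 + 3 * I) ^ n + (1 - I) * (4 - 3 * I) ^ n)

lemma dumas_pow_int (n : ℕ) : ∃ x y : ℤ, (4 + 3 * I) ^ n = (x : ℂ) + y * I ∧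
    (4 - 3 * I) ^ n = (x : ℂ) - y * I ∧ Odd (x - y) := by
  induction n with
  | zero => exact ⟨1, 0, by simp, by simp, by decide⟩
  | succ n ih =>
    obtain ⟨x, y, h1, h2, k, hk⟩ := ih
    refine ⟨4 * x - 3 * y, 3 * x + 4 * y, ?_, ?_, k - 3 * y, by linarith⟩
    · rw [pow_succ, h1]; push_cast
      linear_combination (3 * (y : ℂ)) * I_sq
    · rw [pow_succ, h2]; push_cast
      linear_combination (3 * (y : ℂ)) * I_sq

lemma dumas_re_ne (n : ℕ) : (dumasSigmaC n).re ≠ 0 := by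
  obtain ⟨x, y, h1, h2, ho⟩ := dumas_pow_int n
  have h : dumasSigmaC n = ((3 * (x - y) : ℝ) : ℂ) := by
    rw [dumasSigmaC, h1, h2]; push_cast
    linear_combination (3 * (y : ℂ)) * I_sq
  rw [h, ofReal_re]
  intro h0
  have : x - y = 0 := by
    have : (x : ℝ) - y = 0 := by linarith
    exact_mod_cast this
  rw [this] at ho
  exact absurd ho (by decide)

lemma dumas_re_trig {t : ℝ} (hc : Real.cos t = 4 / 5) (hs : Real.sin t = 3 / 5) (n : ℕ) :
    (dumasSigmaC n).re = 3 * 5 ^ n * (Real.cos (n * t) - Real.sin (n * t)) := by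
  have hp : (4 + 3 * I) ^ n =
      5 ^ n * (((Real.cos (n * t) : ℝ) : ℂ) + ((Real.sin (n * t) : ℝ) : ℂ) * I) := by
    have : (4 + 3 * I : ℂ) = 5 * (Complex.cos t + Complex.sin t * I) := by
      rw [← ofReal_cos, ← ofReal_sin, hc, hs]; push_cast; ring
    rw [this, mul_pow, Complex.cos_add_sin_mul_I_pow]; push_cast; rfl
  have hm : (4 - 3 * I) ^ n =
      5 ^ n * (((Real.cos (n * t) : ℝ) : ℂ) - ((Real.sin (n * t) : ℝ) : ℂ) * I) := by
    have := congrArg (starRingEnd ℂ) hp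
    simp only [map_pow, map_add, map_mul, conj_I, conj_ofReal, Complex.conj_ofNat] at this
    rw [sub_eq_add_neg, ← mul_neg, this]; ring
  have h : dumasSigmaC n =
      ((3 * 5 ^ n * (Real.cos (n * t) - Real.sin (n * t)) : ℝ) : ℂ) := by
    rw [dumasSigmaC, hp, hm, ofReal_mul, ofReal_sub]
    push_cast
    linear_combination (3 * 5 ^ n * Complex.sin (n * t)) * I_sq
  rw [h, ofReal_re]

lemma dumas_unbdd (M : ℝ) :
    ∃ n : ℕ, M < |(dumasSigmaC n).re / (dumasSigmaC (n + 1)).re| := by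
  obtain ⟨t, hc, hs⟩ : ∃ t : ℝ, Real.cos t = 4 / 5 ∧ Real.sin t = 3 / 5 := by
    refine ⟨Real.arccos (4 / 5), Real.cos_arccos (by norm_num) (by norm_num), ?_⟩
    rw [Real.sin_arccos, show (1 - (4 / 5) ^ 2 : ℝ) = (3 / 5) ^ 2 by norm_num]
    exact Real.sqrt_sq (by norm_num)
  have hirr : Irrational (t / (2 * Real.pi)) := by
    rintro ⟨q, hq⟩
    have hpi := Real.pi_pos
    have := niven (θ := t) ⟨2 * q, by push_cast; rw [hq]; field_simp⟩
      ⟨4 / 5, by rw [hc]; norm_num⟩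
    rw [hc] at this
    norm_num at this
  have hdense : DenseRange (fun n : ℕ => n • (t : Real.Angle)) := by
    have : Fact (0 < 2 * Real.pi) := ⟨by positivity⟩
    have := (AddCircle.denseRange_zsmul_coe_iff (a := t) (p := 2 * Real.pi)).2 hirr
    exact (denseRange_zsmul_iff_nsmul (G := AddCircle (2 * Real.pi))).1 this
  set δ : ℝ := min (1 / 2) (1 / 25 / (|M| + 1)) with hδ
  have hM : 0 < |M| + 1 := by positivity
  have hδ0 : 0 < δ := by positivity
  let g : Real.Angle → ℝ := fun φ =>
    |(φ + (t : Real.Angle)).cos - (φ + (t : Real.Angle)).sin|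
  have hg : Continuous g :=
    ((Real.Angle.continuous_cos.comp (continuous_add_const _)).sub
      (Real.Angle.continuous_sin.comp (continuous_add_const _))).abs
  obtain ⟨n, hn⟩ := hdense.exists_mem_open (hg.isOpen_preimage _ (isOpen_Iio (a := δ)))
    ⟨((Real.pi / 4 - t : ℝ) : Real.Angle), by
      simp only [g, Set.mem_preimage, Set.mem_Iio, ← Real.Angle.coe_add, Real.Angle.cos_coe,
        Real.Angle.sin_coe, sub_add_cancel, Real.cos_pi_div_four, Real.sin_pi_div_four]
      simpa using hδ0⟩
  have hn' : |Real.cos (n * t + t) - Real.sin (n * t + t)| < δ := by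
    simpa only [g, Set.mem_preimage, Set.mem_Iio, ← Real.Angle.coe_nsmul, ← Real.Angle.coe_add,
      Real.Angle.cos_coe, Real.Angle.sin_coe, nsmul_eq_mul] using hn
  refine ⟨n, ?_⟩
  have hne := dumas_re_ne (n + 1)
  have e1 := dumas_re_trig hc hs n
  have e2 := dumas_re_trig hc hs (n + 1)
  rw [show ((n + 1 : ℕ) : ℝ) * t = n * t + t by push_cast; ring] at e2
  have hC : Real.cos (n * t) = 4 / 5 * Real.cos (n * t + t) + 3 / 5 * Real.sin (n * t + t) := by
    have := Real.cos_sub (n * t + t) t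
    rw [add_sub_cancel_right, hc, hs] at this; linarith
  have hS : Real.sin (n * t) = 4 / 5 * Real.sin (n * t + t) - 3 / 5 * Real.cos (n * t + t) := by
    have := Real.sin_sub (n * t + t) t
    rw [add_sub_cancel_right, hc, hs] at this; linarith
  rw [hC, hS] at e1
  have hsq := Real.sin_sq_add_cos_sq (n * t + t)
  rw [e2] at hne
  rw [e1, e2]
  generalize Real.cos (n * t + t) = c at *
  generalize Real.sin (n * t + t) = s at *
  have hd : c - s ≠ 0 := right_ne_zero_of_mul hne
  have hd2 : |c - s| < 1 / 2 := hn'.trans_le (min_le_left _ _)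
  have hd3 : |c - s| < 1 / 25 / (|M| + 1) := hn'.trans_le (min_le_right _ _)
  have hdp : 0 < |c - s| := abs_pos.2 hd
  have heq : 3 * 5 ^ n * (4 / 5 * c + 3 / 5 * s - (4 / 5 * s - 3 / 5 * c)) /
      (3 * 5 ^ (n + 1) * (c - s)) = ((7 * c - s) / 25) / (c - s) := by
    field_simp; ring
  rw [heq, abs_div, lt_div_iff₀ hdp]
  rw [lt_div_iff₀ hM] at hd3
  have hnum : 1 / 25 ≤ |(7 * c - s) / 25| := by
    have he : 1 ≤ |c + s| := by
      rw [← abs_one, ← sq_le_sq, ]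
      have := sq_lt_sq' (abs_lt.1 hd2).1 (abs_lt.1 hd2).2
      nlinarith
    rw [abs_lt] at hd2
    rcases le_abs'.1 he with h | h
    · exact le_abs'.2 (Or.inl (by linarith))
    · exact le_abs'.2 (Or.inr (by linarith))
  nlinarith [le_abs_self M]

/-- The sequence `a n = Σ_D(n-1)/Σ_D(n)` is unbounded; in particular it does
not converge. -/
theorem dumas_ratio_unbounded :
    (∀ M : ℝ, ∃ n : ℕ, M < |(dumasSigmaC n).re / (dumasSigmaC (n + 1)).re|) ∧
    (∀ L : ℝ, ¬ Tendsto (fun n : ℕ => (dumasSigmaC n).re / (dumasSigmaC (n + 1)).re)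
        atTop (nhds L)) := by
  refine ⟨dumas_unbdd, fun L hL => ?_⟩
  obtain ⟨B, hB⟩ := (Metric.isBounded_range_of_tendsto _ hL).exists_norm_le
  obtain ⟨n, hn⟩ := dumas_unbdd B
  have := hB _ ⟨n, rfl⟩
  rw [Real.norm_eq_abs] at this
  linarith
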